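/- arXiv:1407.3988 — 7 statements merged into one kernel-verified Lean document; each statement's English description precedes it below -/
import Mathlib

section
/- Let 𝒜₀ be a finite set, A₀ a zero-one 𝒜₀×𝒜₀ matrix, and let φ be a flip for the topological Markov chain (X_{A₀}, σ_{A₀}), i.e. a homeomorphism φ : X_{A₀} → X_{A₀} with σ_{A₀} ∘ φ = φ ∘ σ_{A₀}⁻¹ and φ ∘ φ = id. Then there exist a finite set 𝒜, a flip pair (A, J) over 𝒜, and a homeomorphism θ : X_{A₀} → X_A such that θ ∘ σ_{A₀} = σ_A ∘ θ and θ ∘ φ = φ_{J,A} ∘ θ. (Lemma 2.1: every shift-flip system of finite type is conjugate to one determined by a flip pair.) -/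
open Matrix

/-- A zero-one integer matrix. -/
def IsZeroOne {α β : Type*} (M : Matrix α β ℤ) : Prop := ∀ a b, M a b = 0 ∨ M a b = 1

/-- A flip pair: a pair `(A, J)` of zero-one square matrices with `AJ = JAᵀ` and `J² = I`. -/
def IsFlipPair {α : Type*} [Fintype α] [DecidableEq α] (A J : Matrix α α ℤ) : Prop :=
  IsZeroOne A ∧ IsZeroOne J ∧ A * J = J * Aᵀ ∧ J * J = 1

/-- The topological Markov chain `X_A` determined by `A`, as a subtype of `ℤ → α`
(which carries the product topology when `α` is a topological space). -/
abbrev SFT {α : Type*} (A : Matrix α α ℤ) :=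
  {x : ℤ → α // ∀ i : ℤ, A (x i) (x (i + 1)) = 1}

/-- The shift map `σ_A` on `X_A`, as a bijection: `σ_A(x)_i = x_{i+1}`. -/
def shiftEquiv {α : Type*} (A : Matrix α α ℤ) : Equiv.Perm (SFT A) where
  toFun x := ⟨fun i => x.1 (i + 1), fun i => x.2 (i + 1)⟩
  invFun x := ⟨fun i => x.1 (i - 1), fun i => by
    have h := x.2 (i - 1); rwa [show i - 1 + 1 = i + 1 - 1 by ring] at h⟩
  left_inv x := Subtype.ext (funext fun i => by
    show x.1 (i - 1 + 1) = x.1 i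
    norm_num)
  right_inv x := Subtype.ext (funext fun i => by
    show x.1 (i + 1 - 1) = x.1 i
    norm_num)

/-- The transition matrix of the code `p` of the bijection `σ`: it allows `a → b` when some point
has code `a` and its image under `σ` has code `b`. -/
noncomputable def codeMatrix {X α : Type*} (σ : Equiv.Perm X) (p : X → α) : Matrix α α ℤ :=
  open Classical in Matrix.of fun a b => if ∃ x, p x = a ∧ p (σ x) = b then 1 else 0

theorem codeMatrix_eq_one_iff {X α : Type*} (σ : Equiv.Perm X) (p : X → α) (a b : α) :
    codeMatrix σ p a b = 1 ↔ ∃ x, p x = a ∧ p (σ x) = b := by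
  simp [codeMatrix]

theorem isFlipPair_codeMatrix {X α : Type*} [Fintype α] [DecidableEq α] (σ : Equiv.Perm X)
    (φ : X → X) (hrev : ∀ x, σ (φ x) = φ (σ⁻¹ x)) (p : X → α) (τ : α → α)
    (hτ : Function.Involutive τ) (hpφ : ∀ x, p (φ x) = τ (p x)) :
    IsFlipPair (codeMatrix σ p) (Matrix.of fun a b => if τ a = b then 1 else 0) := by
  have swap : ∀ a b, (∃ x, p x = a ∧ p (σ x) = τ b) → ∃ x, p x = b ∧ p (σ x) = τ a := by
    rintro a b ⟨x, rfl, hx⟩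
    refine ⟨φ (σ x), by rw [hpφ, hx, hτ], ?_⟩
    rw [hrev, Equiv.Perm.inv_eq_iff_eq.2 rfl, hpφ]
  have hτ' : ∀ a b, τ a = b ↔ a = τ b := fun a b => hτ.eq_iff
  refine ⟨fun a b => ?_, fun a b => ?_, ?_, ?_⟩
  · simp only [codeMatrix, Matrix.of_apply]
    split_ifs <;> simp
  · simp only [Matrix.of_apply]
    split_ifs <;> simp
  · ext a b
    have h : (∃ x, p x = a ∧ p (σ x) = τ b) ↔ ∃ x, p x = b ∧ p (σ x) = τ a :=
      ⟨swap a b, swap b a⟩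
    have h1 : codeMatrix σ p a (τ b) = codeMatrix σ p b (τ a) := by
      simp only [codeMatrix, Matrix.of_apply]
      congr 1
      exact propext h
    simpa only [Matrix.mul_apply, Matrix.of_apply, Matrix.transpose_apply, hτ' _ b, mul_ite, ite_mul,
      mul_one, one_mul, mul_zero, zero_mul, Finset.sum_ite_eq, Finset.sum_ite_eq', Finset.mem_univ,
      if_true] using h1
  · ext a b
    simp [Matrix.mul_apply, Matrix.one_apply, hτ', hτ b]

/-- A continuous code `p` of a compact system that separates orbits and realizes every sequence of
consistent transitions conjugates the system to the Markov chain of its transition matrix. -/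
theorem exists_homeomorph_codeMatrix {X α : Type*} [TopologicalSpace X] [CompactSpace X]
    [TopologicalSpace α] [DiscreteTopology α] (σ : Equiv.Perm X)
    (hσ : ∀ i : ℤ, Continuous (σ ^ i : Equiv.Perm X)) (p : X → α) (hp : Continuous p)
    (hinj : ∀ x x', (∀ i : ℤ, p ((σ ^ i) x) = p ((σ ^ i) x')) → x = x')
    (hsurj : ∀ z : ℤ → X, (∀ i, p (z (i + 1)) = p (σ (z i))) →
      ∃ x, ∀ i : ℤ, p ((σ ^ i) x) = p (z i)) :
    ∃ θ : X ≃ₜ SFT (codeMatrix σ p), ∀ (x : X) (i : ℤ), (θ x).1 i = p ((σ ^ i) x) := by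
  let θ : X → SFT (codeMatrix σ p) := fun x => ⟨fun i => p ((σ ^ i) x), fun i => by
    rw [codeMatrix_eq_one_iff]
    exact ⟨(σ ^ i) x, rfl, by dsimp only; rw [add_comm, _root_.zpow_add, zpow_one, Equiv.Perm.mul_apply]⟩⟩
  have hbij : Function.Bijective θ := by
    refine ⟨fun x x' h => hinj x x' fun i => congrFun (congrArg Subtype.val h) i, fun y => ?_⟩
    choose z hz hz' using fun i => (codeMatrix_eq_one_iff σ p _ _).1 (y.2 i)
    obtain ⟨x, hx⟩ := hsurj z fun i => by rw [hz, hz']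
    exact ⟨x, Subtype.ext (funext fun i => (hx i).trans (hz i))⟩
  have hcont : Continuous θ :=
    Continuous.subtype_mk (continuous_pi fun i => hp.comp (hσ i)) _
  exact ⟨Continuous.homeoOfEquivCompactToT2 (f := Equiv.ofBijective θ hbij) hcont,
    fun _ _ => rfl⟩

theorem shiftEquiv_zpow_apply {α : Type*} (A : Matrix α α ℤ) (i : ℤ) (x : SFT A) (j : ℤ) :
    ((shiftEquiv A ^ i) x).1 j = x.1 (j + i) := by
  induction i generalizing x with
  | zero => simp
  | succ i ih =>
    rw [_root_.zpow_add, zpow_one, Equiv.Perm.mul_apply, ih]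
    exact congrArg x.1 (by ring)
  | pred i ih =>
    rw [_root_.zpow_sub, zpow_one, Equiv.Perm.mul_apply, ih]
    exact congrArg x.1 (by ring)

theorem zpow_apply_of_reversal {X : Type*} (σ : Equiv.Perm X) (φ : X → X)
    (hrev : ∀ x, σ (φ x) = φ (σ⁻¹ x)) (i : ℤ) (x : X) :
    (σ ^ i) (φ x) = φ ((σ ^ (-i)) x) := by
  induction i generalizing x with
  | zero => simp
  | succ i ih =>
    rw [_root_.zpow_add, zpow_one, Equiv.Perm.mul_apply, hrev, ih, neg_add, _root_.zpow_add, _root_.zpow_neg_one,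
      Equiv.Perm.mul_apply]
  | pred i ih =>
    have h : σ⁻¹ (φ x) = φ (σ x) := by
      rw [Equiv.Perm.inv_eq_iff_eq, hrev, Equiv.Perm.inv_eq_iff_eq.2 rfl]
    rw [_root_.zpow_sub, zpow_one, Equiv.Perm.mul_apply, h, ih, neg_sub, sub_neg_eq_add, add_comm,
      _root_.zpow_add, zpow_one, Equiv.Perm.mul_apply, neg_neg]

theorem isClosed_setOf_sft {α : Type*} [TopologicalSpace α] [DiscreteTopology α]
    (A : Matrix α α ℤ) : IsClosed {x : ℤ → α | ∀ i : ℤ, A (x i) (x (i + 1)) = 1} := by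
  rw [Set.ofPred_forall]
  refine isClosed_iInter fun i => ?_
  have h : Continuous fun x : ℤ → α => (x i, x (i + 1)) := by fun_prop
  exact isClosed_eq ((continuous_of_discreteTopology (f := fun q : α × α => A q.1 q.2)).comp h)
    continuous_const

theorem compactSpace_sft {α : Type*} [Finite α] [TopologicalSpace α] [DiscreteTopology α]
    (A : Matrix α α ℤ) : CompactSpace (SFT A) :=
  isCompact_iff_compactSpace.1 (isClosed_setOf_sft A).isCompact

theorem continuous_sft_apply {α : Type*} [TopologicalSpace α] (A : Matrix α α ℤ) (i : ℤ) :
    Continuous fun x : SFT A => x.1 i :=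
  (continuous_apply i).comp continuous_subtype_val

theorem continuous_shiftEquiv_zpow {α : Type*} [TopologicalSpace α] (A : Matrix α α ℤ) (i : ℤ) :
    Continuous (shiftEquiv A ^ i : Equiv.Perm (SFT A)) := by
  refine continuous_induced_rng.2 (continuous_pi fun j => ?_)
  simpa only [Function.comp_apply, shiftEquiv_zpow_apply] using continuous_sft_apply A (j + i)

/-- A continuous map from a Markov chain to a discrete space depends on finitely many
coordinates. -/
theorem exists_window {α β : Type*} [Finite α] [TopologicalSpace α] [DiscreteTopology α]
    [TopologicalSpace β] [DiscreteTopology β] (A : Matrix α α ℤ) (f : SFT A → β)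
    (hf : Continuous f) :
    ∃ n : ℕ, ∀ x x' : SFT A, (∀ j : ℤ, |j| ≤ n → x.1 j = x'.1 j) → f x = f x' := by
  have := compactSpace_sft A
  by_contra! hcon
  let K : ℕ → Set (SFT A × SFT A) := fun n =>
    {q | (∀ j : ℤ, |j| ≤ n → q.1.1 j = q.2.1 j) ∧ f q.1 ≠ f q.2}
  have hclosed : ∀ n, IsClosed (K n) := fun n => by
    refine IsClosed.inter ?_ ?_
    · change IsClosed {q : SFT A × SFT A | ∀ j : ℤ, |j| ≤ n → q.1.1 j = q.2.1 j}
      simp only [Set.ofPred_forall]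
      exact isClosed_iInter fun j => isClosed_iInter fun _ =>
        isClosed_eq ((continuous_sft_apply A j).comp continuous_fst)
          ((continuous_sft_apply A j).comp continuous_snd)
    · exact (isClosed_discrete {q : β × β | q.1 ≠ q.2}).preimage
        ((hf.comp continuous_fst).prodMk (hf.comp continuous_snd))
  obtain ⟨q, hq⟩ := IsCompact.nonempty_iInter_of_sequence_nonempty_isCompact_isClosed K
    (fun n q hq => ⟨fun j hj => hq.1 j (hj.trans (by simp)), hq.2⟩)
    (fun n => let ⟨x, x', h⟩ := hcon n; ⟨(x, x'), h⟩) (hclosed 0).isCompact hclosed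
  rw [Set.mem_iInter] at hq
  exact (hq 0).2 (congrArg f (Subtype.ext (funext fun j =>
    (hq j.natAbs).1 j (by rw [Int.natCast_natAbs]))))

theorem eq_apply_zero_of_diagonal {β : Type*} (n : ℤ) (g : ℤ → ℤ → β)
    (hg : ∀ i j, |j| ≤ n → |j + 1| ≤ n → g (i + 1) j = g i (j + 1)) (i j : ℤ) (hj : |j| ≤ n) :
    g i j = g (i + j) 0 := by
  induction j generalizing i with
  | zero => simp
  | succ j ih =>
    have hj' : |(j : ℤ)| ≤ n := by rw [abs_le] at *; omega
    rw [← hg i j hj' hj, ih _ hj']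
    exact congrArg (g · 0) (by ring)
  | pred j ih =>
    have hj' : |(-j : ℤ)| ≤ n := by rw [abs_le] at *; omega
    have h := hg (i - 1) (-j - 1) hj (by simpa using hj')
    rw [sub_add_cancel, sub_add_cancel] at h
    rw [h, ih _ hj']
    exact congrArg (g · 0) (by ring)

/-- The central blocks of radius `n` of `x` and of `φ x`. -/
def windowCode {α : Type*} (A : Matrix α α ℤ) (φ : SFT A → SFT A) (n : ℕ) (x : SFT A) :
    (Finset.Icc (-(n : ℤ)) n → α) × (Finset.Icc (-(n : ℤ)) n → α) :=
  (fun j => x.1 j, fun j => (φ x).1 j)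

theorem windowCode_eq_iff {α : Type*} (A : Matrix α α ℤ) (φ : SFT A → SFT A) (n : ℕ)
    (x x' : SFT A) : windowCode A φ n x = windowCode A φ n x' ↔
      ∀ j : ℤ, |j| ≤ n → x.1 j = x'.1 j ∧ (φ x).1 j = (φ x').1 j := by
  simp only [windowCode, Prod.mk.injEq, funext_iff, Subtype.forall, Finset.mem_Icc, abs_le]
  exact ⟨fun h j hj => ⟨h.1 j hj, h.2 j hj⟩,
    fun h => ⟨fun j hj => (h j hj).1, fun j hj => (h j hj).2⟩⟩

theorem exists_forall_windowCode_eq {α : Type*} (A : Matrix α α ℤ) (φ : SFT A → SFT A)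
    (hrev : ∀ x, shiftEquiv A (φ x) = φ ((shiftEquiv A)⁻¹ x)) (n : ℕ)
    (hn : ∀ x x' : SFT A, (∀ j : ℤ, |j| ≤ n → x.1 j = x'.1 j) → (φ x).1 0 = (φ x').1 0)
    (z : ℤ → SFT A)
    (hz : ∀ i, windowCode A φ n (z (i + 1)) = windowCode A φ n (shiftEquiv A (z i))) :
    ∃ x, ∀ i : ℤ, windowCode A φ n ((shiftEquiv A ^ i) x) = windowCode A φ n (z i) := by
  simp only [windowCode_eq_iff] at hz ⊢
  have hφ : ∀ (x : SFT A) (i j : ℤ),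
      (φ ((shiftEquiv A ^ i) x)).1 j = (φ x).1 (j - i) := fun x i j => by
    have h := zpow_apply_of_reversal (shiftEquiv A) φ hrev (-i) x
    rw [neg_neg] at h
    rw [← h, shiftEquiv_zpow_apply, sub_eq_add_neg]
  have hleft : ∀ i j : ℤ, |j| ≤ n → (z i).1 j = (z (i + j)).1 0 :=
    eq_apply_zero_of_diagonal n (fun i j => (z i).1 j) fun i j hj _ => (hz i j hj).1
  have hright : ∀ i j : ℤ, |j| ≤ n → (φ (z i)).1 j = (φ (z (i - j))).1 0 := fun i j hj => by
    have h := eq_apply_zero_of_diagonal n (fun i j => (φ (z (-i))).1 j) (fun i j _ hj' => by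
      have h := (hz (-(i + 1)) (j + 1) hj').2
      have h' := hφ (z (-(i + 1))) 1 (j + 1)
      rw [zpow_one] at h'
      rw [h', add_sub_cancel_right] at h
      rw [← h]
      exact congrArg (fun k => (φ (z k)).1 (j + 1)) (by ring)) (-i) j hj
    simp only [neg_neg] at h
    rw [h]
    exact congrArg (fun k => (φ (z k)).1 0) (by ring)
  have h0 : |(0 : ℤ)| ≤ n := by simp
  let x : SFT A := ⟨fun i => (z i).1 0, fun i => by
    dsimp only
    rw [(hz i 0 h0).1]
    exact (z i).2 0⟩
  have hx : ∀ i j : ℤ, |j| ≤ n → ((shiftEquiv A ^ i) x).1 j = (z i).1 j := fun i j hj => by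
    rw [shiftEquiv_zpow_apply, hleft i j hj, add_comm]
  refine ⟨x, fun i j hj => ⟨hx i j hj, ?_⟩⟩
  rw [hright i j hj, ← hn _ _ (hx (i - j)), hφ, hφ]
  exact congrArg (φ x).1 (by ring)

/-- **Lemma 2.1.** Every shift-flip system of finite type `(X_{A₀}, σ_{A₀}, φ)`
is conjugate to one determined by a flip pair `(A, J)`, via a homeomorphism `θ` intertwining
the shifts and carrying `φ` to the flip `φ_{J,A}` (characterized by
`φ_{J,A}(y)_i = τ_J(y_{-i})`). -/
theorem stmt1 {𝒜₀ : Type*} [Fintype 𝒜₀] [DecidableEq 𝒜₀]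
    [TopologicalSpace 𝒜₀] [DiscreteTopology 𝒜₀]
    (A₀ : Matrix 𝒜₀ 𝒜₀ ℤ) (hA₀ : IsZeroOne A₀)
    (φ : SFT A₀ ≃ₜ SFT A₀)
    (hrev : ∀ x, shiftEquiv A₀ (φ x) = φ ((shiftEquiv A₀)⁻¹ x))
    (hinv : ∀ x, φ (φ x) = x) :
    ∃ (𝒜 : Type) (_ : Fintype 𝒜) (_ : DecidableEq 𝒜)
      (_ : TopologicalSpace 𝒜) (_ : DiscreteTopology 𝒜)
      (A J : Matrix 𝒜 𝒜 ℤ) (τ : 𝒜 → 𝒜),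
      IsFlipPair A J ∧ (∀ a b, J a b = 1 ↔ τ a = b) ∧
      ∃ θ : SFT A₀ ≃ₜ SFT A,
        (∀ x, θ (shiftEquiv A₀ x) = shiftEquiv A (θ x)) ∧
        ∀ (x : SFT A₀) (i : ℤ), (θ (φ x)).1 i = τ ((θ x).1 (-i)) := by
  have := compactSpace_sft A₀
  obtain ⟨n, hn⟩ := exists_window A₀ (fun x => (φ x).1 0)
    ((continuous_sft_apply A₀ 0).comp φ.continuous)
  let e := Fintype.equivFin
    ((Finset.Icc (-(n : ℤ)) n → 𝒜₀) × (Finset.Icc (-(n : ℤ)) n → 𝒜₀))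
  let σ := shiftEquiv A₀
  let p := fun x => e (windowCode A₀ φ n x)
  let τ := fun a => e (e.symm a).swap
  have hτ : Function.Involutive τ := fun a => by simp [τ]
  have hpφ : ∀ x, p (φ x) = τ (p x) := fun x => by simp [p, τ, windowCode, hinv]
  have hp : Continuous p := by
    refine continuous_of_discreteTopology.comp (Continuous.prodMk ?_ ?_)
    · exact continuous_pi fun j => continuous_sft_apply A₀ j
    · exact continuous_pi fun j => (continuous_sft_apply A₀ j).comp φ.continuous
  obtain ⟨θ, hθ⟩ := exists_homeomorph_codeMatrix σ (continuous_shiftEquiv_zpow A₀) p hp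
    (fun x x' h => Subtype.ext (funext fun i => by
      have h := ((windowCode_eq_iff A₀ φ n _ _).1 (e.injective (h i)) 0 (by simp)).1
      simpa only [σ, shiftEquiv_zpow_apply, zero_add] using h))
    (fun z hz => by
      obtain ⟨x, hx⟩ := exists_forall_windowCode_eq A₀ φ hrev n hn z fun i => e.injective (hz i)
      exact ⟨x, fun i => congrArg e (hx i)⟩)
  refine ⟨_, inferInstance, inferInstance, inferInstance, inferInstance, codeMatrix σ p, _, τ,
    isFlipPair_codeMatrix σ φ hrev p τ hτ hpφ, fun a b => by simp, θ,
    fun x => Subtype.ext (funext fun i => ?_), fun x i => ?_⟩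
  · change (θ (σ x)).1 i = (θ x).1 (i + 1)
    rw [hθ, hθ, _root_.zpow_add, zpow_one, Equiv.Perm.mul_apply]
  · rw [hθ, hθ, zpow_apply_of_reversal σ φ hrev, hpφ]
end

section
/- Let (A, J) be a flip pair over a finite set 𝒜 and (B, K) a flip pair over a finite set 𝒜′, and suppose (R, S) is a half elementary equivalence from (A, J) to (B, K), i.e. R and S are zero-one matrices with A = RS, B = SR, and S = KRᵀJ. Then the flip systems (X_A, σ_A, φ_{J,A}) and (X_B, σ_B, σ_B ∘ φ_{K,B}) are conjugate: there exists a homeomorphism θ : X_A → X_B with θ ∘ σ_A = σ_B ∘ θ and θ ∘ φ_{J,A} = (σ_B ∘ φ_{K,B}) ∘ θ. (Proposition 2.2.) -/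
open Matrix

/-- Paths of length two through zero-one matrices are unique when the product is zero-one. -/
theorem existsUnique_mid_of_mul_eq_one {α β γ : Type*} [Fintype β]
    {R : Matrix α β ℤ} {S : Matrix β γ ℤ} (hR : IsZeroOne R) (hS : IsZeroOne S)
    {a : α} {c : γ} (h : (R * S) a c = 1) : ∃! b, R a b = 1 ∧ S b c = 1 := by
  classical
  have key : ∀ b, R a b * S b c = if R a b = 1 ∧ S b c = 1 then 1 else 0 := by
    intro b
    rcases hR a b with h | h <;> rcases hS b c with h' | h' <;> simp [h, h']
  rw [Matrix.mul_apply, Finset.sum_congr rfl fun b _ => key b, Finset.sum_boole] at h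
  obtain ⟨b, hb⟩ := Finset.card_eq_one.1 (by exact_mod_cast h)
  simp only [Finset.ext_iff, Finset.mem_filter, Finset.mem_univ, true_and,
    Finset.mem_singleton] at hb
  exact ⟨b, (hb b).2 rfl, fun b' h' => (hb b').1 h'⟩

theorem mul_apply_eq_one {α β γ : Type*} [Fintype β]
    {R : Matrix α β ℤ} {S : Matrix β γ ℤ} (hR : IsZeroOne R) (hS : IsZeroOne S)
    (hRS : IsZeroOne (R * S)) {a : α} {b : β} {c : γ} (h : R a b = 1) (h' : S b c = 1) :
    (R * S) a c = 1 := by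
  refine (hRS a c).resolve_left fun h0 => ?_
  have hnonneg : ∀ b ∈ Finset.univ, 0 ≤ R a b * S b c := fun b _ => by
    rcases hR a b with h | h <;> rcases hS b c with h' | h' <;> simp [h, h']
  rw [Matrix.mul_apply, Finset.sum_eq_zero_iff_of_nonneg hnonneg] at h0
  simpa [h, h'] using h0 b (Finset.mem_univ b)

/-- The continuous map `X_{RS} → X_{SR}` reading off the intermediate symbols. -/
theorem exists_continuous_mid {α β : Type*} [Fintype α] [Fintype β]
    [TopologicalSpace α] [DiscreteTopology α] [TopologicalSpace β]
    {R : Matrix α β ℤ} {S : Matrix β α ℤ} (hR : IsZeroOne R) (hS : IsZeroOne S)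
    (hSR : IsZeroOne (S * R)) :
    ∃ θ : SFT (R * S) → SFT (S * R), Continuous θ ∧
      ∀ x i b, R (x.1 i) b = 1 ∧ S b (x.1 (i + 1)) = 1 ↔ b = (θ x).1 i := by
  have hmid : ∀ p : {p : α × α // (R * S) p.1 p.2 = 1},
      ∃ b, ∀ b', R p.1.1 b' = 1 ∧ S b' p.1.2 = 1 ↔ b' = b := fun p => by
    obtain ⟨b, hb, hu⟩ := existsUnique_mid_of_mul_eq_one hR hS p.2
    exact ⟨b, fun b' => ⟨hu b', fun h => h ▸ hb⟩⟩
  choose f hf using hmid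
  refine ⟨fun x => ⟨fun i => f ⟨(x.1 i, x.1 (i + 1)), x.2 i⟩, fun i => ?_⟩, ?_,
    fun x i b => hf ⟨(x.1 i, x.1 (i + 1)), x.2 i⟩ b⟩
  · exact mul_apply_eq_one hS hR hSR ((hf _ _).2 rfl).2
      ((hf ⟨(x.1 (i + 1), x.1 (i + 1 + 1)), x.2 (i + 1)⟩ _).2 rfl).1
  · refine Continuous.subtype_mk (continuous_pi fun i => ?_) _
    exact (continuous_of_discreteTopology (f := f)).comp
      (Continuous.subtype_mk (((continuous_apply i).comp continuous_subtype_val).prodMk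
        ((continuous_apply (i + 1)).comp continuous_subtype_val)) _)

theorem continuous_shiftEquiv_symm {α : Type*} [TopologicalSpace α] (A : Matrix α α ℤ) :
    Continuous (shiftEquiv A).symm :=
  continuous_induced_rng.2
    (continuous_pi fun i => (continuous_apply (i - 1)).comp continuous_subtype_val)

theorem involutive_of_mul_self_eq_one {α : Type*} [Fintype α] [DecidableEq α]
    {J : Matrix α α ℤ} (hJ : IsZeroOne J) (hJJ : J * J = 1) {τ : α → α}
    (hτ : ∀ a b, J a b = 1 ↔ τ a = b) : Function.Involutive τ := fun a => by
  obtain ⟨b, ⟨h, h'⟩, -⟩ := existsUnique_mid_of_mul_eq_one hJ hJ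
    (show (J * J) a a = 1 by simp [hJJ])
  rw [(hτ a b).1 h, (hτ b a).1 h']

theorem apply_eq_ite {α : Type*} [DecidableEq α] {J : Matrix α α ℤ} (hJ : IsZeroOne J)
    {τ : α → α} (hτ : ∀ a b, J a b = 1 ↔ τ a = b) (a b : α) :
    J a b = if τ a = b then 1 else 0 := by
  split_ifs with h
  · exact (hτ a b).2 h
  · exact (hJ a b).resolve_right fun h' => h ((hτ a b).1 h')

/-- **Proposition 2.2.** A half elementary equivalence `(R, S)` from the flip
pair `(A, J)` to the flip pair `(B, K)` induces a conjugacy from `(X_A, σ_A, φ_{J,A})` to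
`(X_B, σ_B, σ_B ∘ φ_{K,B})`. -/
theorem stmt2 {𝒜 𝒜' : Type*} [Fintype 𝒜] [DecidableEq 𝒜] [Fintype 𝒜'] [DecidableEq 𝒜']
    [TopologicalSpace 𝒜] [DiscreteTopology 𝒜] [TopologicalSpace 𝒜'] [DiscreteTopology 𝒜']
    (A J : Matrix 𝒜 𝒜 ℤ) (B K : Matrix 𝒜' 𝒜' ℤ)
    (hAJ : IsFlipPair A J) (hBK : IsFlipPair B K)
    (τJ : 𝒜 → 𝒜) (hτJ : ∀ a b, J a b = 1 ↔ τJ a = b)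
    (τK : 𝒜' → 𝒜') (hτK : ∀ a b, K a b = 1 ↔ τK a = b)
    (φJ : SFT A → SFT A) (hφJ : ∀ x i, (φJ x).1 i = τJ (x.1 (-i)))
    (φK : SFT B → SFT B) (hφK : ∀ x i, (φK x).1 i = τK (x.1 (-i)))
    (R : Matrix 𝒜 𝒜' ℤ) (S : Matrix 𝒜' 𝒜 ℤ)
    (hR : IsZeroOne R) (hS : IsZeroOne S)
    (h1 : A = R * S) (h2 : B = S * R) (h3 : S = K * Rᵀ * J) :
    ∃ θ : SFT A ≃ₜ SFT B,
      (∀ x, θ (shiftEquiv A x) = shiftEquiv B (θ x)) ∧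
      (∀ x, θ (φJ x) = shiftEquiv B (φK (θ x))) := by
  have hτJJ := involutive_of_mul_self_eq_one hAJ.2.1 hAJ.2.2.2 hτJ
  have hτKK := involutive_of_mul_self_eq_one hBK.2.1 hBK.2.2.2 hτK
  have hSR : ∀ b a, S b a = R (τJ a) (τK b) := fun b a => by
    rw [h3]
    simp [Matrix.mul_apply, apply_eq_ite hAJ.2.1 hτJ, apply_eq_ite hBK.2.1 hτK,
      hτJJ.eq_iff, eq_comm]
  have hRS : ∀ a b, R a b = S (τK b) (τJ a) := fun a b => by rw [hSR, hτJJ, hτKK]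
  subst h1 h2
  obtain ⟨θ, hθc, hθ⟩ := exists_continuous_mid hR hS hBK.1
  obtain ⟨η, hηc, hη⟩ := exists_continuous_mid hS hR hAJ.1
  refine ⟨{ toFun := θ
            invFun := fun y => (shiftEquiv (R * S)).symm (η y)
            left_inv := fun x => ?_
            right_inv := fun y => ?_
            continuous_toFun := hθc
            continuous_invFun := (continuous_shiftEquiv_symm _).comp hηc },
    fun x => ?_, fun x => ?_⟩
  · rw [Equiv.symm_apply_eq]
    refine Subtype.ext (funext fun i => ((hη (θ x) i _).1 ⟨?_, ?_⟩).symm)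
    · exact ((hθ x i _).2 rfl).2
    · exact ((hθ x (i + 1) _).2 rfl).1
  · refine Subtype.ext (funext fun i => ((hθ _ i _).1 ⟨?_, ?_⟩).symm)
    · have h := ((hη y (i - 1) _).2 rfl).2
      rwa [sub_add_cancel] at h
    · have h := ((hη y i _).2 rfl).1
      change S (y.1 i) ((η y).1 (i + 1 - 1)) = 1
      rwa [add_sub_cancel_right]
  · exact Subtype.ext (funext fun i => ((hθ _ i _).1 ((hθ x (i + 1) _).2 rfl)).symm)
  · refine Subtype.ext (funext fun i => ((hθ _ i _).1 ?_).symm)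
    change R _ ((φK (θ x)).1 (i + 1)) = 1 ∧ S ((φK (θ x)).1 (i + 1)) _ = 1
    obtain ⟨h, h'⟩ := (hθ x (-(i + 1)) _).2 rfl
    rw [show -(i + 1) + 1 = -i by ring] at h'
    rw [hφK, hφJ, hφJ]
    exact ⟨by rwa [← hSR], by rwa [← hRS]⟩
end

section
/- Let (A, J) be a flip pair over a finite set 𝒜 and, for n ≥ 1, let ℬ_n denote the set of A-admissible words of length n (words a₁⋯aₙ ∈ 𝒜ⁿ with A(a_i, a_{i+1}) = 1 for 1 ≤ i < n). Define the zero-one ℬ_n×ℬ_n matrices A_n and J_n by: A_n(u, v) = 1 iff u_{i+1} = v_i for 1 ≤ i < n and the word u₁⋯uₙvₙ is A-admissible, and J_n(u, v) = 1 iff v_i = τ_J(u_{n+1-i}) for 1 ≤ i ≤ n. Define the zero-one ℬ_n×ℬ_{n+1} matrix R_n by R_n(u, v) = 1 iff u = v₁⋯vₙ, and the zero-one ℬ_{n+1}×ℬ_n matrix S_n by S_n(v, u) = 1 iff u = v₂⋯v_{n+1}. Then (A_n, J_n) and (A_{n+1}, J_{n+1}) are flip pairs and (R_n, S_n) is a half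 elementary equivalence from (A_n, J_n) to (A_{n+1}, J_{n+1}): A_n = R_n S_n, A_{n+1} = S_n R_n, and S_n = J_{n+1} R_nᵀ J_n. Consequently (A, J) = (A₁, J₁) is strong shift-flip equivalent to (A_{n+1}, J_{n+1}) with lag n. (Lemma 2.3.) -/
open Matrix

/-- A pair of square integer matrices over some finite alphabet. -/
structure MatPair where
  ι : Type*
  [fin : Fintype ι]
  [deq : DecidableEq ι]
  A : Matrix ι ι ℤ
  J : Matrix ι ι ℤ

attribute [instance] MatPair.fin MatPair.deq

def MatPair.IsFlip (P : MatPair) : Prop := IsFlipPair P.A P.J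

/-- A half elementary equivalence from `(P.A, P.J)` to `(Q.A, Q.J)`: a pair `(R, S)` of
zero-one matrices with `P.A = RS`, `Q.A = SR`, and `S = Q.J Rᵀ P.J`. -/
def HalfElemEquiv (P Q : MatPair) : Prop :=
  ∃ (R : Matrix P.ι Q.ι ℤ) (S : Matrix Q.ι P.ι ℤ),
    IsZeroOne R ∧ IsZeroOne S ∧ P.A = R * S ∧ Q.A = S * R ∧ S = Q.J * Rᵀ * P.J

/-- A strong shift-flip equivalence of lag `k` from `P` to `Q`: a chain of `k` half elementary
equivalences through flip pairs. -/
def SSFE (P Q : MatPair) (k : ℕ) : Prop :=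
  ∃ c : Fin (k + 1) → MatPair, c 0 = P ∧ c (Fin.last k) = Q ∧
    (∀ i, (c i).IsFlip) ∧ ∀ i : Fin k, HalfElemEquiv (c i.castSucc) (c i.succ)

/-- `w : Fin n → α` is an `A`-admissible word. -/
def AdmWord {α : Type*} (A : Matrix α α ℤ) {n : ℕ} (w : Fin n → α) : Prop :=
  ∀ i : Fin n, ∀ h : (i : ℕ) + 1 < n, A (w i) (w ⟨(i : ℕ) + 1, h⟩) = 1

/-- `ℬ_n`: the set of `A`-admissible words of length `n`. -/
abbrev Bn {α : Type*} [Fintype α] (A : Matrix α α ℤ) (n : ℕ) := {w : Fin n → α // AdmWord A w}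

attribute [local instance] Classical.propDecidable

variable {α : Type*} [Fintype α] [DecidableEq α]

/-- The matrix `A_n` (here with `n = k + 1 ≥ 1`): `A_n(u, v) = 1` iff `u_{i+1} = v_i` for
`1 ≤ i < n` and the word `u₁⋯uₙvₙ` is `A`-admissible. -/
noncomputable def blockA (A : Matrix α α ℤ) (k : ℕ) : Matrix (Bn A (k+1)) (Bn A (k+1)) ℤ :=
  Matrix.of fun u v =>
    if (∀ j : Fin k, u.1 j.succ = v.1 j.castSucc) ∧
       AdmWord A (Fin.snoc u.1 (v.1 (Fin.last k))) then 1 else 0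

/-- The matrix `J_n` (here with `n = k + 1 ≥ 1`): `J_n(u, v) = 1` iff
`v_i = τ(u_{n+1-i})` for `1 ≤ i ≤ n`. -/
noncomputable def blockJ (A : Matrix α α ℤ) (τ : α → α) (k : ℕ) :
    Matrix (Bn A (k+1)) (Bn A (k+1)) ℤ :=
  Matrix.of fun u v => if ∀ j : Fin (k+1), v.1 j = τ (u.1 j.rev) then 1 else 0

/-- The matrix `R_n` (here with `n = k + 1 ≥ 1`): `R_n(u, v) = 1` iff `u = v₁⋯vₙ`. -/
noncomputable def blockR (A : Matrix α α ℤ) (k : ℕ) : Matrix (Bn A (k+1)) (Bn A (k+2)) ℤ :=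
  Matrix.of fun u v => if ∀ j : Fin (k+1), u.1 j = v.1 j.castSucc then 1 else 0

/-- The matrix `S_n` (here with `n = k + 1 ≥ 1`): `S_n(v, u) = 1` iff `u = v₂⋯v_{n+1}`. -/
noncomputable def blockS (A : Matrix α α ℤ) (k : ℕ) : Matrix (Bn A (k+2)) (Bn A (k+1)) ℤ :=
  Matrix.of fun v u => if ∀ j : Fin (k+1), u.1 j = v.1 j.succ then 1 else 0

/-- A word of positive length is admissible iff each pair of consecutive letters is. -/
theorem admWord_succ_iff {α : Type*} {A : Matrix α α ℤ} {n : ℕ} {w : Fin (n + 1) → α} :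
    AdmWord A w ↔ ∀ i : Fin n, A (w i.castSucc) (w i.succ) = 1 := by
  constructor
  · intro h i
    exact h i.castSucc (by simp)
  · intro h i hi
    exact h ⟨i, by omega⟩

theorem admWord_snoc_iff {α : Type*} {A : Matrix α α ℤ} {n : ℕ} {w : Fin (n + 1) → α} {x : α} :
    AdmWord A (Fin.snoc w x : Fin (n + 2) → α) ↔ AdmWord A w ∧ A (w (Fin.last n)) x = 1 := by
  rw [admWord_succ_iff, admWord_succ_iff, Fin.forall_fin_succ']
  simp only [Fin.snoc_castSucc, Fin.succ_last, Fin.snoc_last, Fin.succ_castSucc]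

namespace Bn

variable {α : Type*} [Fintype α] {A : Matrix α α ℤ}

/-- The word without its last letter. -/
def dropLast {k : ℕ} (v : Bn A (k + 2)) : Bn A (k + 1) :=
  ⟨fun j => v.1 j.castSucc, admWord_succ_iff.2 fun i => admWord_succ_iff.1 v.2 i.castSucc⟩

/-- The word without its first letter. -/
def tail {k : ℕ} (v : Bn A (k + 2)) : Bn A (k + 1) :=
  ⟨fun j => v.1 j.succ, admWord_succ_iff.2 fun i => admWord_succ_iff.1 v.2 i.succ⟩

theorem ext_dropLast_tail {k : ℕ} {v w : Bn A (k + 2)} (hi : v.dropLast = w.dropLast)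
    (ht : v.tail = w.tail) : v = w := by
  refine Subtype.ext (funext fun j => ?_)
  induction j using Fin.cases with
  | zero => exact congrFun (congrArg Subtype.val hi) 0
  | succ j => exact congrFun (congrArg Subtype.val ht) j

/-- The reversed word with `τ` applied to every letter. -/
def flip {τ : α → α} (hA : ∀ a b, A (τ b) (τ a) = A a b) {k : ℕ} (u : Bn A (k + 1)) :
    Bn A (k + 1) :=
  ⟨fun j => τ (u.1 j.rev), admWord_succ_iff.2 fun i => by
    rw [Fin.rev_castSucc, Fin.rev_succ, hA]
    exact admWord_succ_iff.1 u.2 i.rev⟩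

theorem flip_involutive {τ : α → α} (hA : ∀ a b, A (τ b) (τ a) = A a b)
    (hτ : Function.Involutive τ) {k : ℕ} :
    Function.Involutive (flip hA : Bn A (k + 1) → Bn A (k + 1)) := by
  intro u
  refine Subtype.ext (funext fun j => ?_)
  simp [flip, hτ _]

theorem flip_dropLast_flip {τ : α → α} (hA : ∀ a b, A (τ b) (τ a) = A a b)
    (hτ : Function.Involutive τ) {k : ℕ} (v : Bn A (k + 2)) :
    (v.flip hA).dropLast.flip hA = v.tail := by
  refine Subtype.ext (funext fun j => ?_)
  simp [flip, dropLast, tail, hτ _, Fin.rev_castSucc]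

end Bn

section Block

variable (A : Matrix α α ℤ)

theorem blockR_apply {k : ℕ} (u : Bn A (k + 1)) (v : Bn A (k + 2)) :
    blockR A k u v = if u = v.dropLast then 1 else 0 := by
  simp only [blockR, Matrix.of_apply, Subtype.ext_iff, funext_iff, Bn.dropLast]

theorem blockS_apply {k : ℕ} (v : Bn A (k + 2)) (u : Bn A (k + 1)) :
    blockS A k v u = if u = v.tail then 1 else 0 := by
  simp only [blockS, Matrix.of_apply, Subtype.ext_iff, funext_iff, Bn.tail]

theorem blockJ_apply {τ : α → α} (hA : ∀ a b, A (τ b) (τ a) = A a b) {k : ℕ}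
    (u v : Bn A (k + 1)) : blockJ A τ k u v = if v = u.flip hA then 1 else 0 := by
  simp only [blockJ, Matrix.of_apply, Subtype.ext_iff, funext_iff, Bn.flip]

theorem blockA_apply_eq_exists {k : ℕ} (u v : Bn A (k + 1)) :
    blockA A k u v = if ∃ w : Bn A (k + 2), u = w.dropLast ∧ v = w.tail then 1 else 0 := by
  rw [blockA, Matrix.of_apply]
  refine if_congr ⟨fun h => ⟨⟨_, h.2⟩, ?_, ?_⟩, ?_⟩ rfl rfl
  · refine Subtype.ext (funext fun j => ?_)
    simp [Bn.dropLast]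
  · refine Subtype.ext (funext fun j => ?_)
    induction j using Fin.lastCases with
    | last => simp [Bn.tail]
    | cast j => simp only [Bn.tail, Fin.succ_castSucc, Fin.snoc_castSucc, h.1]
  · rintro ⟨w, rfl, rfl⟩
    refine ⟨fun j => rfl, admWord_snoc_iff.2 ⟨w.dropLast.2, ?_⟩⟩
    exact admWord_succ_iff.1 w.2 (Fin.last k)

theorem blockA_succ_apply {k : ℕ} (u v : Bn A (k + 2)) :
    blockA A (k + 1) u v = if u.tail = v.dropLast then 1 else 0 := by
  rw [blockA, Matrix.of_apply]
  refine if_congr ⟨fun h => Subtype.ext (funext h.1), fun h => ?_⟩ rfl rfl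
  have h' : ∀ j : Fin (k + 1), u.1 j.succ = v.1 j.castSucc :=
    congrFun (congrArg Subtype.val h)
  refine ⟨h', admWord_snoc_iff.2 ⟨u.2, ?_⟩⟩
  rw [← Fin.succ_last, h' (Fin.last k)]
  exact admWord_succ_iff.1 v.2 (Fin.last k)

theorem blockA_eq_blockR_mul_blockS (k : ℕ) : blockA A k = blockR A k * blockS A k := by
  ext u v
  rw [blockA_apply_eq_exists, Matrix.mul_apply]
  simp only [blockR_apply, blockS_apply, ← ite_and, mul_ite, mul_one, mul_zero]
  split_ifs with h
  · obtain ⟨w, rfl, rfl⟩ := h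
    rw [Finset.sum_eq_single w]
    · simp
    · intro w' _ hw
      rw [if_neg]
      rintro ⟨h₁, h₂⟩
      exact hw (Bn.ext_dropLast_tail (by simp_all) (by simp_all))
    · simp
  · refine (Finset.sum_eq_zero fun w _ => if_neg ?_).symm
    rintro ⟨h₁, h₂⟩
    exact h ⟨w, by simp_all, by simp_all⟩

theorem blockA_succ_eq_blockS_mul_blockR (k : ℕ) :
    blockA A (k + 1) = blockS A k * blockR A k := by
  ext u v
  simp [blockA_succ_apply, Matrix.mul_apply, blockR_apply, blockS_apply, eq_comm]

variable {A} {τ : α → α}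

theorem blockS_eq (hA : ∀ a b, A (τ b) (τ a) = A a b)
    (hτ : Function.Involutive τ) (k : ℕ) :
    blockS A k = blockJ A τ (k + 1) * (blockR A k)ᵀ * blockJ A τ k := by
  ext v u
  simp only [Matrix.mul_apply, Matrix.transpose_apply, blockR_apply, blockS_apply,
    blockJ_apply A hA, ite_mul, one_mul, zero_mul, Finset.sum_ite_eq', Finset.mem_univ, if_true,
    Bn.flip_dropLast_flip hA hτ]

theorem blockJ_mul_self (hA : ∀ a b, A (τ b) (τ a) = A a b)
    (hτ : Function.Involutive τ) (k : ℕ) : blockJ A τ k * blockJ A τ k = 1 := by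
  ext u v
  simp only [Matrix.mul_apply, blockJ_apply A hA, ite_mul, one_mul, zero_mul,
    Finset.sum_ite_eq', Finset.mem_univ, if_true, Bn.flip_involutive hA hτ u,
    Matrix.one_apply, eq_comm]

theorem blockJ_transpose (hA : ∀ a b, A (τ b) (τ a) = A a b)
    (hτ : Function.Involutive τ) (k : ℕ) : (blockJ A τ k)ᵀ = blockJ A τ k := by
  ext u v
  rw [Matrix.transpose_apply, blockJ_apply A hA, blockJ_apply A hA]
  exact if_congr ((Bn.flip_involutive hA hτ).eq_iff.symm.trans eq_comm) rfl rfl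

theorem isFlipPair_block (hA : ∀ a b, A (τ b) (τ a) = A a b)
    (hτ : Function.Involutive τ) (k : ℕ) : IsFlipPair (blockA A k) (blockJ A τ k) := by
  have key : blockA A k * blockJ A τ k = blockR A k * blockJ A τ (k + 1) * (blockR A k)ᵀ := by
    rw [blockA_eq_blockR_mul_blockS, blockS_eq hA hτ]
    simp only [Matrix.mul_assoc, blockJ_mul_self hA hτ, Matrix.mul_one]
  refine ⟨fun u v => ?_, fun u v => ?_, ?_, blockJ_mul_self hA hτ k⟩
  · rw [blockA_apply_eq_exists]
    split_ifs <;> simp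
  · rw [blockJ_apply A hA]
    split_ifs <;> simp
  · calc blockA A k * blockJ A τ k = (blockA A k * blockJ A τ k)ᵀ := by
          rw [key]
          simp only [Matrix.transpose_mul, Matrix.transpose_transpose, blockJ_transpose hA hτ,
            Matrix.mul_assoc]
      _ = blockJ A τ k * (blockA A k)ᵀ := by
          rw [Matrix.transpose_mul, blockJ_transpose hA hτ]

end Block

theorem isZeroOne_blockR (A : Matrix α α ℤ) (k : ℕ) : IsZeroOne (blockR A k) := fun u v => by
  rw [blockR_apply]
  split_ifs <;> simp

theorem isZeroOne_blockS (A : Matrix α α ℤ) (k : ℕ) : IsZeroOne (blockS A k) := fun u v => by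
  rw [blockS_apply]
  split_ifs <;> simp

namespace IsFlipPair

variable {A J : Matrix α α ℤ} {τ : α → α}

theorem apply_eq_ite (h : IsFlipPair A J) (hτ : ∀ a b, J a b = 1 ↔ τ a = b) (a b : α) :
    J a b = if τ a = b then 1 else 0 := by
  split_ifs with hab
  · exact (hτ a b).2 hab
  · exact (h.2.1 a b).resolve_right fun h₁ => hab ((hτ a b).1 h₁)

theorem involutive (h : IsFlipPair A J) (hτ : ∀ a b, J a b = 1 ↔ τ a = b) :
    Function.Involutive τ := by
  intro a
  have ha := congrFun (congrFun h.2.2.2 a) a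
  by_contra hne
  simp only [Matrix.mul_apply, h.apply_eq_ite hτ, ite_mul, one_mul, zero_mul, Finset.sum_ite_eq,
    Finset.mem_univ, if_true, if_neg hne, Matrix.one_apply_eq] at ha
  exact zero_ne_one ha

theorem apply_flip (h : IsFlipPair A J) (hτ : ∀ a b, J a b = 1 ↔ τ a = b) (a b : α) :
    A (τ b) (τ a) = A a b := by
  have hab := congrFun (congrFun h.2.2.1 a) (τ b)
  simpa [Matrix.mul_apply, h.apply_eq_ite hτ, (h.involutive hτ).injective.eq_iff] using hab.symm

end IsFlipPair

/-- **Lemma 2.3.** For every `n = k + 1 ≥ 1`, the pairs `(A_n, J_n)` and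
`(A_{n+1}, J_{n+1})` are flip pairs, `(R_n, S_n)` is a half elementary equivalence from
`(A_n, J_n)` to `(A_{n+1}, J_{n+1})`, and consequently `(A₁, J₁)` is strong shift-flip
equivalent to `(A_{n+1}, J_{n+1})` with lag `n`. -/
theorem stmt3 {α : Type*} [Fintype α] [DecidableEq α]
    (A J : Matrix α α ℤ) (hAJ : IsFlipPair A J)
    (τ : α → α) (hτ : ∀ a b, J a b = 1 ↔ τ a = b) (k : ℕ) :
    IsFlipPair (blockA A k) (blockJ A τ k) ∧
    IsFlipPair (blockA A (k+1)) (blockJ A τ (k+1)) ∧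
    IsZeroOne (blockR A k) ∧ IsZeroOne (blockS A k) ∧
    blockA A k = blockR A k * blockS A k ∧
    blockA A (k+1) = blockS A k * blockR A k ∧
    blockS A k = blockJ A τ (k+1) * (blockR A k)ᵀ * blockJ A τ k ∧
    SSFE (MatPair.mk (Bn A 1) (blockA A 0) (blockJ A τ 0))
      (MatPair.mk (Bn A (k+2)) (blockA A (k+1)) (blockJ A τ (k+1))) (k+1) := by
  have hA := hAJ.apply_flip hτ
  have hinv := hAJ.involutive hτ
  refine ⟨isFlipPair_block hA hinv k, isFlipPair_block hA hinv (k + 1), isZeroOne_blockR A k,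
    isZeroOne_blockS A k, blockA_eq_blockR_mul_blockS A k, blockA_succ_eq_blockS_mul_blockR A k,
    blockS_eq hA hinv k, ?_⟩
  exact ⟨fun i => MatPair.mk (Bn A (i + 1)) (blockA A i) (blockJ A τ i), rfl, rfl,
    fun i => isFlipPair_block hA hinv i, fun i => ⟨blockR A i, blockS A i, isZeroOne_blockR A i,
      isZeroOne_blockS A i, blockA_eq_blockR_mul_blockS A i, blockA_succ_eq_blockS_mul_blockR A i,
      blockS_eq hA hinv i⟩⟩
end

section
/- Let (X, T, φ) be a flip system. Then (X, T, T ∘ φ) is again a flip system, and for every positive integer m: p_{2m-1, 0}(T, φ) = p_{2m-1, 0}(T, T ∘ φ), p_{2m, 0}(T, φ) = p_{2m, 1}(T, T ∘ φ), and p_{2m, 1}(T, φ) = p_{2m, 0}(T, T ∘ φ). (Proposition 3.1.) -/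
open Matrix

/-- `pFix T m = p_m(T)`: the number of points fixed by `T^m`. -/
noncomputable def pFix {X : Type*} (T : Equiv.Perm X) (m : ℕ) : ℕ :=
  Nat.card {x : X // (T ^ m) x = x}

/-- `pFlip T φ m n = p_{m,n}(T, φ)`: the number of points fixed by both `T^m` and `T^n ∘ φ`. -/
noncomputable def pFlip {X : Type*} (T : Equiv.Perm X) (φ : X → X) (m : ℕ) (n : ℤ) : ℕ :=
  Nat.card {x : X // (T ^ m) x = x ∧ (T ^ n) (φ x) = x}

theorem pFlip_comp_left {X : Type*} (T : Equiv.Perm X) (φ : X → X) (m : ℕ) (n : ℤ) :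
    pFlip T (fun x => T (φ x)) m n = pFlip T φ m (n + 1) := by
  simp only [pFlip, _root_.zpow_add_one, Equiv.Perm.mul_apply]

theorem zpow_apply_flip {X : Type*} {T φ : Equiv.Perm X}
    (hrev : ∀ x, T (φ x) = φ (T⁻¹ x)) (k : ℤ) (x : X) :
    φ ((T ^ k) x) = (T ^ (-k)) (φ x) := by
  have h : SemiconjBy φ T⁻¹ T := Equiv.ext fun x => (hrev x).symm
  have h' := Equiv.congr_fun (h.zpow_right (-k)).eq x
  simpa using h'

/-- Translating by `T ^ k` shifts the second index of `pFlip` by `2 * k`, and that index only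
matters modulo the first one. -/
theorem pFlip_eq_of_dvd {X : Type*} {T φ : Equiv.Perm X}
    (hrev : ∀ x, T (φ x) = φ (T⁻¹ x)) {m : ℕ} {n n' : ℤ} (k : ℤ)
    (hdvd : (m : ℤ) ∣ n + 2 * k - n') :
    pFlip T φ m n = pFlip T φ m n' := by
  refine Nat.card_congr ((T ^ k).subtypeEquiv fun x => ?_)
  have hcomm : (T ^ m) ((T ^ k) x) = (T ^ k) ((T ^ m) x) := by
    rw [← Equiv.Perm.mul_apply, ← Equiv.Perm.mul_apply,
      ((Commute.refl T).pow_left m |>.zpow_right k).eq]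
  rw [hcomm, (T ^ k).apply_eq_iff_eq]
  refine and_congr_right fun hx => ?_
  obtain ⟨c, hc⟩ := hdvd
  have hfix : (T ^ ((m : ℤ) * c)) x = x := by
    rw [_root_.zpow_mul, zpow_natCast]
    exact Equiv.Perm.zpow_apply_eq_self_of_apply_eq_self hx c
  have hleft : (T ^ n') (φ ((T ^ k) x)) = (T ^ (n' - k - n)) ((T ^ n) (φ x)) := by
    rw [zpow_apply_flip hrev]
    simp only [← Equiv.Perm.mul_apply, ← mul_assoc, ← _root_.zpow_add]
    congr 3
    ring
  have hright : (T ^ k) x = (T ^ (n' - k - n)) x := by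
    conv_rhs => rw [← hfix]
    rw [← Equiv.Perm.mul_apply, ← _root_.zpow_add]
    congr 2
    linarith
  rw [hleft, hright, (T ^ (n' - k - n)).apply_eq_iff_eq]

/-- **Proposition 3.1.** If `(X, T, φ)` is a flip system then so is
`(X, T, T ∘ φ)`, and for every positive integer `m`:
`p_{2m-1,0}(T, φ) = p_{2m-1,0}(T, T∘φ)`, `p_{2m,0}(T, φ) = p_{2m,1}(T, T∘φ)`, and
`p_{2m,1}(T, φ) = p_{2m,0}(T, T∘φ)`. -/
theorem stmt7 {X : Type*} (T φ : Equiv.Perm X)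
    (hrev : ∀ x, T (φ x) = φ (T⁻¹ x)) (hinv : ∀ x, φ (φ x) = x)
    (m : ℕ) (hm : 1 ≤ m) :
    (∀ x, T ((T * φ) x) = (T * φ) (T⁻¹ x)) ∧
    (∀ x, (T * φ) ((T * φ) x) = x) ∧
    pFlip T ⇑φ (2 * m - 1) 0 = pFlip T (fun x => T (φ x)) (2 * m - 1) 0 ∧
    pFlip T ⇑φ (2 * m) 0 = pFlip T (fun x => T (φ x)) (2 * m) 1 ∧
    pFlip T ⇑φ (2 * m) 1 = pFlip T (fun x => T (φ x)) (2 * m) 0 := by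
  refine ⟨fun x => ?_, fun x => ?_, ?_, ?_, ?_⟩
  · exact congrArg T (hrev x)
  · simp [hrev, hinv]
  · rw [pFlip_comp_left]
    exact pFlip_eq_of_dvd hrev m ⟨1, by push_cast [show 1 ≤ 2 * m by lia]; ring⟩
  · rw [pFlip_comp_left]
    exact pFlip_eq_of_dvd hrev 1 ⟨0, by norm_num⟩
  · rw [pFlip_comp_left, zero_add]
end

section
/- Let (A, J) be a flip pair over a finite set 𝒜. Then for every positive integer m, p_{2m, 0}(σ_A, φ_{J,A}) = Δ_Jᵀ A^m Δ_J, where Δ_M denotes the column vector of diagonal entries of a square matrix M. (Theorem 3.3, second formula.) -/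
open Matrix

theorem shiftEquiv_pow_apply {α : Type*} (A : Matrix α α ℤ) (n : ℕ) (x : SFT A) (i : ℤ) :
    ((shiftEquiv A ^ n) x).1 i = x.1 (i + n) := by
  induction n generalizing i with
  | zero => simp
  | succ n ih =>
    rw [pow_succ']
    change ((shiftEquiv A ^ n) x).1 (i + 1) = _
    rw [ih, Nat.cast_succ, add_assoc, add_comm 1]

/-- A bilinear form in a matrix power is a weighted sum over paths. -/
theorem dotProduct_pow_mulVec_eq_sum {α : Type*} [Fintype α] [DecidableEq α]
    (A : Matrix α α ℤ) (m : ℕ) (f g : α → ℤ) :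
    f ⬝ᵥ (A ^ m).mulVec g = ∑ p : Fin (m + 1) → α,
      f (p 0) * (∏ i : Fin m, A (p i.castSucc) (p i.succ)) * g (p (Fin.last m)) := by
  induction m generalizing f with
  | zero =>
    simp only [pow_zero, one_mulVec, dotProduct]
    refine Fintype.sum_equiv (Equiv.funUnique (Fin 1) α).symm _ _ fun a => ?_
    simp
  | succ m ih =>
    rw [pow_succ', ← mulVec_mulVec, dotProduct_mulVec, ih,
      ← (Fin.consEquiv fun _ : Fin (m + 2) => α).sum_comp, Fintype.sum_prod_type_right]
    refine Finset.sum_congr rfl fun p _ => ?_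
    simp only [vecMul, dotProduct, Finset.sum_mul]
    refine Finset.sum_congr rfl fun a _ => ?_
    simp only [Fin.consEquiv_apply, Fin.prod_univ_succ, Fin.castSucc_zero, Fin.cons_zero,
      Fin.cons_succ, ← Fin.succ_castSucc, ← Fin.succ_last]
    ring

theorem prod_eq_ite_of_zero_or_one {ι : Type*} [Fintype ι] (f : ι → ℤ)
    (hf : ∀ i, f i = 0 ∨ f i = 1) : ∏ i, f i = if ∀ i, f i = 1 then 1 else 0 := by
  split_ifs with h
  · exact Finset.prod_eq_one fun i _ => h i
  · push Not at h
    obtain ⟨i, hi⟩ := h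
    exact Finset.prod_eq_zero (Finset.mem_univ i) ((hf i).resolve_right hi)

theorem IsFlipPair.involutive_s10 {α : Type*} [Fintype α] [DecidableEq α] {A J : Matrix α α ℤ}
    (h : IsFlipPair A J) {τ : α → α} (hτ : ∀ a b, J a b = 1 ↔ τ a = b) :
    Function.Involutive τ := by
  obtain ⟨-, hJ, -, hJJ⟩ := h
  have hJ' : ∀ a b, J a b = if τ a = b then 1 else 0 := fun a b => by
    have := hJ a b
    have := hτ a b
    grind
  intro a
  have := congrFun (congrFun hJJ a) a
  simp only [mul_apply, hJ', ite_mul, one_mul, zero_mul, Finset.sum_ite_eq, Finset.mem_univ,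
    if_true, one_apply_eq] at this
  grind

theorem IsFlipPair.apply_flip_s10 {α : Type*} [Fintype α] [DecidableEq α] {A J : Matrix α α ℤ}
    (h : IsFlipPair A J) {τ : α → α} (hτ : ∀ a b, J a b = 1 ↔ τ a = b) (a b : α) :
    A (τ b) (τ a) = A a b := by
  have hinv := h.involutive_s10 hτ
  obtain ⟨-, hJ, hAJ, -⟩ := h
  have hJ' : ∀ a b, J a b = if a = τ b then 1 else 0 := fun a b => by
    have := hJ a b
    have := hτ a b
    have := hinv a
    have := hinv b
    grind
  have hJ'' : ∀ a b, J a b = if τ a = b then 1 else 0 := fun a b => by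
    have := hJ a b
    have := hτ a b
    grind
  have key := congrFun (congrFun hAJ a) (τ b)
  rw [mul_apply, mul_apply] at key
  simp only [hJ' _ (τ b), hJ'' a, hinv b, mul_ite, mul_one, mul_zero, ite_mul, one_mul, zero_mul,
    Finset.sum_ite_eq, Finset.sum_ite_eq', Finset.mem_univ, if_true, transpose_apply] at key
  exact key.symm

/-- A path of length `m` with `τ`-fixed endpoints unfolds to a `2m`-periodic reflection-symmetric
point of the topological Markov chain. -/
theorem exists_periodic_symmetric_extension {α : Type*} (A : Matrix α α ℤ) (τ : α → α)
    (hA : ∀ a b, A (τ b) (τ a) = A a b) (hinv : Function.Involutive τ) (m : ℤ) (hm : 1 ≤ m)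
    (q : ℤ → α) (hq : ∀ i, 0 ≤ i → i < m → A (q i) (q (i + 1)) = 1)
    (h0 : τ (q 0) = q 0) (h1 : τ (q m) = q m) :
    ∃ x : SFT A, (∀ i, x.1 (i + 2 * m) = x.1 i) ∧ (∀ i, τ (x.1 (-i)) = x.1 i) ∧
      ∀ i, 0 ≤ i → i ≤ m → x.1 i = q i := by
  let y : ℤ → α := fun r => if r ≤ m then q r else τ (q (2 * m - r))
  have hlo : ∀ r, r ≤ m → y r = q r := fun r hr => if_pos hr
  have hhi : ∀ r, m ≤ r → y r = τ (q (2 * m - r)) := fun r hr => by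
    rcases hr.eq_or_lt with rfl | hr
    · rw [hlo _ le_rfl, show 2 * m - m = m by ring, h1]
    · exact if_neg (by lia)
  have hy2 : y (2 * m) = y 0 := by
    rw [hhi _ (by lia), hlo 0 (by lia), sub_self, h0]
  have hstep : ∀ r, 0 ≤ r → r < 2 * m → A (y r) (y (r + 1)) = 1 := fun r hr0 hr => by
    rcases lt_or_ge r m with h | h
    · rw [hlo r h.le, hlo _ (by lia)]
      exact hq r hr0 h
    · rw [hhi r h, hhi _ (by lia), hA, show 2 * m - r = 2 * m - (r + 1) + 1 by ring]
      exact hq _ (by lia) (by lia)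
  have hflip : ∀ r, 0 ≤ r → r ≤ 2 * m → τ (y (2 * m - r)) = y r := fun r hr0 hr => by
    rcases le_total r m with h | h
    · rw [hhi _ (by lia), hlo r h, hinv, sub_sub_cancel]
    · rw [hlo _ (by lia), hhi r h]
  have hmod : ∀ i r, 0 ≤ r → r ≤ 2 * m → 2 * m ∣ i - r → y (i % (2 * m)) = y r := by
    intro i r hr0 hr hd
    rw [Int.emod_eq_emod_iff_emod_sub_eq_zero.mpr (Int.emod_eq_zero_of_dvd hd)]
    rcases hr.eq_or_lt with rfl | hr
    · rw [Int.emod_self, hy2]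
    · rw [Int.emod_eq_of_lt hr0 hr]
  have hr0 : ∀ i : ℤ, 0 ≤ i % (2 * m) := fun i => Int.emod_nonneg i (by lia)
  have hr1 : ∀ i : ℤ, i % (2 * m) < 2 * m := fun i => Int.emod_lt_of_pos i (by lia)
  have hdvd : ∀ i : ℤ, 2 * m ∣ i - i % (2 * m) := fun i => Int.dvd_self_sub_emod
  refine ⟨⟨fun i => y (i % (2 * m)), fun i => ?_⟩, fun i => ?_, fun i => ?_, fun i hi0 hi => ?_⟩
  · have := hr1 i
    change A (y (i % (2 * m))) (y ((i + 1) % (2 * m))) = 1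
    rw [hmod (i + 1) (i % (2 * m) + 1) (by have := hr0 i; lia) (by lia)
      (by rw [add_sub_add_right_eq_sub]; exact hdvd i)]
    exact hstep _ (hr0 i) this
  · simp
  · have h0 := hr0 i
    have h1 := hr1 i
    change τ (y (-i % (2 * m))) = y (i % (2 * m))
    rw [hmod (-i) (2 * m - i % (2 * m)) (by lia) (by lia)
      (by
        obtain ⟨k, hk⟩ := hdvd i
        exact ⟨-k - 1, by linear_combination -hk⟩)]
    exact hflip _ h0 h1.le
  · change y (i % (2 * m)) = q i
    rw [hmod i i hi0 (by lia) (by simp), hlo i hi]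

/-- A periodic reflection-symmetric sequence is determined by its values on half a period. -/
theorem eq_of_periodic_symmetric {α : Type*} {τ : α → α} {m : ℤ} (hm : 1 ≤ m) {x y : ℤ → α}
    (hx : Function.Periodic x (2 * m)) (hy : Function.Periodic y (2 * m))
    (hx' : ∀ i, τ (x (-i)) = x i) (hy' : ∀ i, τ (y (-i)) = y i)
    (h : ∀ i, 0 ≤ i → i ≤ m → x i = y i) : x = y := by
  funext i
  have hr0 : 0 ≤ i % (2 * m) := Int.emod_nonneg i (by lia)
  have hr1 : i % (2 * m) < 2 * m := Int.emod_lt_of_pos i (by lia)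
  have red : ∀ z : ℤ → α, Function.Periodic z (2 * m) → z i = z (i % (2 * m)) := fun z hz => by
    have := hz.int_mul (i / (2 * m)) (i % (2 * m))
    rw [← this]
    congr 1
    have := Int.emod_add_mul_ediv i (2 * m)
    push_cast
    linarith
  rw [red x hx, red y hy]
  rcases le_total (i % (2 * m)) m with hi | hi
  · exact h _ hr0 hi
  · rw [← hx', ← hy', ← hx, ← hy, h _ (by lia) (by lia)]

/-- **Theorem 3.3, second formula.** For a flip pair `(A, J)` and `m ≥ 1`:
`p_{2m,0}(σ_A, φ_{J,A}) = Δ_Jᵀ A^m Δ_J`. -/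
theorem stmt10 {𝒜 : Type*} [Fintype 𝒜] [DecidableEq 𝒜]
    (A J : Matrix 𝒜 𝒜 ℤ) (hAJ : IsFlipPair A J)
    (τ : 𝒜 → 𝒜) (hτ : ∀ a b, J a b = 1 ↔ τ a = b)
    (φJ : SFT A → SFT A) (hφJ : ∀ x i, (φJ x).1 i = τ (x.1 (-i)))
    (m : ℕ) (hm : 1 ≤ m) :
    (pFlip (shiftEquiv A) φJ (2 * m) 0 : ℤ)
      = (fun a => J a a) ⬝ᵥ (A ^ m).mulVec (fun a => J a a) := by
  have hinv := hAJ.involutive_s10 hτ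
  have hflip := hAJ.apply_flip_s10 hτ
  have hper : ∀ x : SFT A, (shiftEquiv A ^ (2 * m)) x = x ↔
      Function.Periodic x.1 (2 * (m : ℤ)) := fun x => by
    simp only [Subtype.ext_iff, funext_iff, shiftEquiv_pow_apply, Function.Periodic]
    push_cast
    rfl
  have hsym : ∀ x : SFT A, (shiftEquiv A ^ (0 : ℤ)) (φJ x) = x ↔
      ∀ i, τ (x.1 (-i)) = x.1 i := fun x => by
    simp [Subtype.ext_iff, funext_iff, hφJ]
  let P : (Fin (m + 1) → 𝒜) → Prop := fun p =>
    J (p 0) (p 0) = 1 ∧ (∀ i : Fin m, A (p i.castSucc) (p i.succ) = 1) ∧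
      J (p (Fin.last m)) (p (Fin.last m)) = 1
  let F : {x : SFT A // (shiftEquiv A ^ (2 * m)) x = x ∧ (shiftEquiv A ^ (0 : ℤ)) (φJ x) = x} →
      {p // P p} := fun x => ⟨fun i => x.1.1 (i : ℕ), by
    obtain ⟨x, hx, hx'⟩ := x
    rw [hper] at hx
    rw [hsym] at hx'
    refine ⟨?_, fun i => ?_, ?_⟩
    · rw [hτ]
      simpa using hx' 0
    · simpa using x.2 (i : ℕ)
    · rw [hτ]
      have h := hx (-m)
      rw [show -(m : ℤ) + 2 * m = m by ring] at h
      have h' := hx' m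
      rw [← h] at h'
      simpa using h'⟩
  have hF : Function.Bijective F := by
    constructor
    · rintro ⟨x, hx, hx'⟩ ⟨y, hy, hy'⟩ hxy
      rw [hper] at hx hy
      rw [hsym] at hx' hy'
      refine Subtype.ext (Subtype.ext (eq_of_periodic_symmetric (m := m) (by lia)
        hx hy hx' hy' fun i hi0 hi => ?_))
      lift i to ℕ using hi0
      exact congrFun (congrArg Subtype.val hxy) ⟨i, by lia⟩
    · rintro ⟨p, hp0, hp, hpm⟩
      rw [hτ] at hp0 hpm
      let q : ℤ → 𝒜 := fun i => p (Fin.ofNat (m + 1) i.toNat)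
      have hq : ∀ i : Fin (m + 1), q (i : ℕ) = p i := fun i => by simp [q]
      have hq0 : q 0 = p 0 := hq 0
      have hqm : q m = p (Fin.last m) := hq (Fin.last m)
      obtain ⟨x, hx, hx', hxq⟩ := exists_periodic_symmetric_extension A τ hflip hinv m
        (by lia) q (fun i hi0 hi => by
          lift i to ℕ using hi0
          have h := hp ⟨i, by lia⟩
          rw [← hq, ← hq] at h
          simpa using h) (by rw [hq0, hp0]) (by rw [hqm, hpm])
      refine ⟨⟨x, (hper x).2 hx, (hsym x).2 hx'⟩, Subtype.ext (funext fun i => ?_)⟩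
      exact (hxq (i : ℕ) (by lia) (by have := i.isLt; lia)).trans (hq i)
  classical
  rw [pFlip, Nat.card_congr (Equiv.ofBijective F hF), Nat.card_eq_fintype_card,
    Fintype.card_subtype, Finset.natCast_card_filter, dotProduct_pow_mulVec_eq_sum]
  refine Finset.sum_congr rfl fun p _ => ?_
  rw [prod_eq_ite_of_zero_or_one _ fun i => hAJ.1 _ _]
  have h0 := hAJ.2.1 (p 0) (p 0)
  have h1 := hAJ.2.1 (p (Fin.last m)) (p (Fin.last m))
  rcases h0 with h0 | h0 <;> rcases h1 with h1 | h1 <;> simp [P, h0, h1]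
end

section
/- Let (A, J) and (B, K) be flip pairs over finite sets and let k be a positive integer. If there is a strong shift-flip equivalence of lag k from (A, J) to (B, K), then there is a shift-flip equivalence of lag k from (A, J) to (B, K), i.e. there exist nonnegative integral matrices R, S with A^k = RS, B^k = SR, AR = RB, and S = KRᵀJ. -/
open Matrix

/-- A shift-flip equivalence of lag `k` from `P` to `Q`. -/
def ShiftFlipEquiv (P Q : MatPair) (k : ℕ) : Prop :=
  ∃ (R : Matrix P.ι Q.ι ℤ) (S : Matrix Q.ι P.ι ℤ),
    (∀ i j, 0 ≤ R i j) ∧ (∀ i j, 0 ≤ S i j) ∧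
    P.A ^ k = R * S ∧ Q.A ^ k = S * R ∧ P.A * R = R * Q.A ∧ S = Q.J * Rᵀ * P.J

theorem IsZeroOne.nonneg {α β : Type*} {M : Matrix α β ℤ} (h : IsZeroOne M) (a : α) (b : β) :
    0 ≤ M a b := by
  rcases h a b with h | h <;> simp [h]

theorem Matrix.mul_entries_nonneg {α β γ : Type*} [Fintype β] {M : Matrix α β ℤ}
    {N : Matrix β γ ℤ} (hM : ∀ i j, 0 ≤ M i j) (hN : ∀ i j, 0 ≤ N i j) (i : α) (j : γ) :
    0 ≤ (M * N) i j :=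
  Finset.sum_nonneg fun l _ => mul_nonneg (hM i l) (hN l j)

theorem Matrix.mul_pow_eq_pow_mul_of_intertwine {α β : Type*} [Fintype α] [DecidableEq α]
    [Fintype β] [DecidableEq β] {A : Matrix α α ℤ} {B : Matrix β β ℤ} {S : Matrix β α ℤ}
    (h : S * A = B * S) (k : ℕ) : S * A ^ k = B ^ k * S := by
  induction k with
  | zero => simp
  | succ k ih => rw [pow_succ, ← Matrix.mul_assoc, ih, Matrix.mul_assoc, h, pow_succ,
      Matrix.mul_assoc]

theorem MatPair.IsFlip.shiftFlipEquiv_zero {P : MatPair} (hP : P.IsFlip) :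
    ShiftFlipEquiv P P 0 := by
  have one_nonneg (i j : P.ι) : 0 ≤ (1 : Matrix P.ι P.ι ℤ) i j := by
    rw [Matrix.one_apply]; split_ifs <;> simp
  exact ⟨1, 1, one_nonneg, one_nonneg, by simp, by simp, by simp, by simp [hP.2.2.2]⟩

theorem ShiftFlipEquiv.trans_halfElemEquiv {P M Q : MatPair} {k : ℕ}
    (h : ShiftFlipEquiv P M k) (hM : M.IsFlip) (h' : HalfElemEquiv M Q) :
    ShiftFlipEquiv P Q (k + 1) := by
  obtain ⟨R, S, hR, hS, hPA, hMA, hPM, hSR⟩ := h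
  obtain ⟨R', S', hR', hS', hM', hQ', hSR'⟩ := h'
  refine ⟨R * R', S' * S, mul_entries_nonneg hR hR'.nonneg,
    mul_entries_nonneg hS'.nonneg hS, ?_, ?_, ?_, ?_⟩
  · calc P.A ^ (k + 1) = P.A * R * S := by rw [pow_succ', hPA, Matrix.mul_assoc]
      _ = R * R' * (S' * S) := by rw [hPM, hM']; simp only [Matrix.mul_assoc]
  · have hS'M : S' * M.A = Q.A * S' := by rw [hM', hQ', Matrix.mul_assoc]
    calc Q.A ^ (k + 1) = Q.A ^ k * S' * R' := by
          rw [pow_succ, Matrix.mul_assoc (Q.A ^ k), ← hQ']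
      _ = S' * M.A ^ k * R' := by rw [mul_pow_eq_pow_mul_of_intertwine hS'M]
      _ = S' * S * (R * R') := by rw [hMA]; simp only [Matrix.mul_assoc]
  · rw [← Matrix.mul_assoc, hPM, hM', hQ']
    simp only [Matrix.mul_assoc]
  · calc S' * S = Q.J * R'ᵀ * (M.J * M.J) * Rᵀ * P.J := by
          rw [hSR', hSR]; simp only [Matrix.mul_assoc]
      _ = Q.J * (R * R')ᵀ * P.J := by
          rw [hM.2.2.2, Matrix.mul_one, Matrix.transpose_mul]; simp only [Matrix.mul_assoc]

theorem SSFE.shiftFlipEquiv {P Q : MatPair} {k : ℕ} (h : SSFE P Q k) : ShiftFlipEquiv P Q k := by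
  obtain ⟨c, rfl, rfl, hflip, hstep⟩ := h
  have key (i : Fin (k + 1)) : ShiftFlipEquiv (c 0) (c i) i := by
    induction i using Fin.induction with
    | zero => exact (hflip 0).shiftFlipEquiv_zero
    | succ i ih => exact ih.trans_halfElemEquiv (hflip _) (hstep i)
  exact key (Fin.last k)

/-- A strong shift-flip equivalence of lag `k` from `(A, J)` to `(B, K)`
yields a shift-flip equivalence of lag `k`: nonnegative integral matrices `R`, `S` with
`A^k = RS`, `B^k = SR`, `AR = RB`, and `S = KRᵀJ`. -/
theorem stmt13 {𝒜 𝒜' : Type} [Fintype 𝒜] [DecidableEq 𝒜] [Fintype 𝒜'] [DecidableEq 𝒜']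
    (A J : Matrix 𝒜 𝒜 ℤ) (B K : Matrix 𝒜' 𝒜' ℤ)
    (hAJ : IsFlipPair A J) (hBK : IsFlipPair B K)
    (k : ℕ) (hk : 0 < k)
    (h : SSFE (MatPair.mk 𝒜 A J) (MatPair.mk 𝒜' B K) k) :
    ∃ (R : Matrix 𝒜 𝒜' ℤ) (S : Matrix 𝒜' 𝒜 ℤ),
      (∀ i j, 0 ≤ R i j) ∧ (∀ i j, 0 ≤ S i j) ∧
      A ^ k = R * S ∧ B ^ k = S * R ∧ A * R = R * B ∧ S = K * Rᵀ * J := by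
  exact h.shiftFlipEquiv
end

section
/- Let A = [[0,1,0,1],[1,0,1,0],[0,1,0,1],[1,0,1,0]] and J = [[0,0,1,0],[0,0,0,1],[1,0,0,0],[0,1,0,0]] be 4×4 zero-one matrices and I the 4×4 identity matrix, so that (A, J) and (A, I) are flip pairs. Then: (i) there is no positive integer k for which there exists a strong shift-flip equivalence of lag k from (A, J) to (A, I); and (ii) the flip systems (X_A, σ_A, φ_{I,A}) and (X_A, σ_A, σ_A ∘ φ_{I,A}) are not conjugate, i.e. there is no homeomorphism θ : X_A → X_A with θ ∘ σ_A = σ_A ∘ θ and θ ∘ φ_{I,A} = (σ_A ∘ φ_{I,A}) ∘ θ. In particular, shift-flip equivalence does not imply strong shift-flip equivalence. -/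
open Matrix

namespace IsZeroOne

variable {α β γ : Type*} {M : Matrix α β ℤ} {N : Matrix β γ ℤ}

theorem mul_term_nonneg (hM : IsZeroOne M) (hN : IsZeroOne N) (a : α) (b : β) (c : γ) :
    0 ≤ M a b * N b c := by
  rcases hM a b with h | h <;> rcases hN b c with h' | h' <;> simp [h, h']

variable [Fintype β]

theorem exists_of_mul_apply_ne_zero (hM : IsZeroOne M) (hN : IsZeroOne N) {a : α} {c : γ}
    (h : (M * N) a c ≠ 0) : ∃ b, M a b = 1 ∧ N b c = 1 := by
  rw [Matrix.mul_apply] at h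
  obtain ⟨b, -, hb⟩ := Finset.exists_ne_zero_of_sum_ne_zero h
  exact ⟨b, (hM a b).resolve_left (left_ne_zero_of_mul hb),
    (hN b c).resolve_left (right_ne_zero_of_mul hb)⟩

theorem one_le_mul_apply (hM : IsZeroOne M) (hN : IsZeroOne N) {a : α} {b : β} {c : γ}
    (h : M a b = 1) (h' : N b c = 1) : 1 ≤ (M * N) a c := by
  rw [Matrix.mul_apply]
  have := Finset.single_le_sum (f := fun d => M a d * N d c)
    (fun d _ => mul_term_nonneg hM hN a d c) (Finset.mem_univ b)
  simpa [h, h'] using this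

theorem mid_unique (hM : IsZeroOne M) (hN : IsZeroOne N) {a : α} {b b' : β} {c : γ}
    (hMN : (M * N) a c = 1) (h₁ : M a b = 1) (h₂ : N b c = 1) (h₁' : M a b' = 1)
    (h₂' : N b' c = 1) : b = b' := by
  classical
  by_contra hne
  rw [Matrix.mul_apply] at hMN
  have := Finset.sum_le_sum_of_subset_of_nonneg (f := fun d => M a d * N d c)
    (Finset.subset_univ {b, b'}) (fun d _ _ => mul_term_nonneg hM hN a d c)
  rw [Finset.sum_pair hne, hMN, h₁, h₂, h₁', h₂'] at this
  norm_num at this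

end IsZeroOne

section Involution

variable {α γ : Type*} [Fintype α] [DecidableEq α] {J : Matrix α α ℤ}

theorem exists_apply_eq_one_of_sq_eq_one (hJ : IsZeroOne J) (hJJ : J * J = 1) (a : α) :
    ∃ b, J a b = 1 ∧ J b a = 1 :=
  hJ.exists_of_mul_apply_ne_zero hJ (by rw [hJJ, Matrix.one_apply_eq]; exact one_ne_zero)

theorem eq_of_sq_eq_one (hJ : IsZeroOne J) (hJJ : J * J = 1) {a b c : α}
    (h : J b a = 1) (h' : J a c = 1) : b = c := by
  by_contra hne
  have := hJ.one_le_mul_apply hJ h h'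
  rw [hJJ, Matrix.one_apply_ne hne] at this
  norm_num at this

theorem apply_symm_of_sq_eq_one (hJ : IsZeroOne J) (hJJ : J * J = 1) {a b : α}
    (h : J a b = 1) : J b a = 1 := by
  obtain ⟨c, hac, hca⟩ := exists_apply_eq_one_of_sq_eq_one hJ hJJ a
  rwa [← eq_of_sq_eq_one hJ hJJ hca h]

theorem mul_apply_of_sq_eq_one (hJ : IsZeroOne J) (hJJ : J * J = 1) (M : Matrix α γ ℤ)
    {a b : α} (h : J a b = 1) (c : γ) : (J * M) a c = M b c := by
  rw [Matrix.mul_apply, Finset.sum_eq_single b, h, one_mul]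
  · intro d _ hd
    rcases hJ a d with h0 | h1
    · rw [h0, zero_mul]
    · exact absurd (eq_of_sq_eq_one hJ hJJ (apply_symm_of_sq_eq_one hJ hJJ h1) h) hd
  · simp

theorem apply_mul_of_sq_eq_one (hJ : IsZeroOne J) (hJJ : J * J = 1) (M : Matrix γ α ℤ)
    {a b : α} (h : J a b = 1) (c : γ) : (M * J) c a = M c b := by
  rw [Matrix.mul_apply, Finset.sum_eq_single b, apply_symm_of_sq_eq_one hJ hJJ h, mul_one]
  · intro d _ hd
    rcases hJ d a with h0 | h1
    · rw [h0, mul_zero]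
    · exact absurd (eq_of_sq_eq_one hJ hJJ h1 h) hd
  · simp

end Involution

/-- Some point of `X_A` is fixed by one of the flips `σ_A ^ m ∘ φ_{J,A}`. -/
def MatPair.HasReversiblePoint (P : MatPair) : Prop :=
  ∃ (n : ℤ) (x : ℤ → P.ι), (∀ i, P.A (x i) (x (i + 1)) = 1) ∧ ∀ i, P.J (x i) (x (n - i)) = 1

theorem HalfElemEquiv.hasReversiblePoint {P Q : MatPair} (h : HalfElemEquiv P Q)
    (hP : P.IsFlip) (hQ : Q.IsFlip) (hr : Q.HasReversiblePoint) : P.HasReversiblePoint := by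
  obtain ⟨R, S, hR, hS, hPA, hQA, hSR⟩ := h
  obtain ⟨hA, hJ, -, hJJ⟩ := hP
  obtain ⟨-, hK, -, hKK⟩ := hQ
  obtain ⟨n, y, hy, hyK⟩ := hr
  have hSapply {b b' : Q.ι} {a a' : P.ι} (hb : Q.J b b' = 1) (ha : P.J a a' = 1) :
      S b a = R a' b' := by
    rw [hSR, apply_mul_of_sq_eq_one hJ hJJ _ ha, mul_apply_of_sq_eq_one hK hKK _ hb,
      Matrix.transpose_apply]
  have hex (i : ℤ) : ∃ a, S (y i) a = 1 ∧ R a (y (i + 1)) = 1 :=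
    hS.exists_of_mul_apply_ne_zero hR (by rw [← hQA, hy i]; exact one_ne_zero)
  choose x hxS hxR using hex
  refine ⟨n - 1, x, fun i => ?_, fun i => ?_⟩
  · have := hR.one_le_mul_apply hS (hxR i) (hxS (i + 1))
    rw [← hPA] at this
    exact (hA _ _).resolve_left (by omega)
  · obtain ⟨a, ha, ha'⟩ := exists_apply_eq_one_of_sq_eq_one hJ hJJ (x i)
    have hK' : Q.J (y (n - 1 - i)) (y (i + 1)) = 1 := by
      have := hyK (n - 1 - i)
      rwa [show n - (n - 1 - i) = i + 1 by ring] at this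
    have haS : S (y (n - 1 - i)) a = 1 := (hSapply hK' ha').trans (hxR i)
    have haR : R a (y (n - 1 - i + 1)) = 1 := by
      rw [show n - 1 - i + 1 = n - i by ring, ← hSapply (hyK i) ha, hxS i]
    have hmid := hy (n - 1 - i)
    rw [hQA] at hmid
    rwa [← hS.mid_unique hR hmid haS haR (hxS _) (hxR _)]

theorem SSFE.hasReversiblePoint {P Q : MatPair} {k : ℕ} (h : SSFE P Q k)
    (hr : Q.HasReversiblePoint) : P.HasReversiblePoint := by
  obtain ⟨c, rfl, rfl, hflip, hstep⟩ := h
  exact Fin.reverseInduction (motive := fun i => (c i).HasReversiblePoint) hr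
    (fun i hi => (hstep i).hasReversiblePoint (hflip _) (hflip _) hi) 0

/-- The point `…010101…` of the four-cycle shift. -/
def alternatingPoint (i : ℤ) : Fin 4 := if Even i then 0 else 1

theorem alternatingPoint_neg (i : ℤ) : alternatingPoint (-i) = alternatingPoint i := by
  simp [alternatingPoint]

theorem alternatingPoint_step (i : ℤ) :
    (!![0,1,0,1; 1,0,1,0; 0,1,0,1; 1,0,1,0] : Matrix (Fin 4) (Fin 4) ℤ)
      (alternatingPoint i) (alternatingPoint (i + 1)) = 1 := by
  rcases Int.even_or_odd i with h | h
  · simp [alternatingPoint, h, Int.not_even_iff_odd.2 h.add_one]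
  · simp [alternatingPoint, Int.not_even_iff_odd.2 h, h.add_one]

theorem not_hasReversiblePoint :
    ¬ (MatPair.mk (Fin 4) !![0,1,0,1; 1,0,1,0; 0,1,0,1; 1,0,1,0]
      !![0,0,1,0; 0,0,0,1; 1,0,0,0; 0,1,0,0]).HasReversiblePoint := by
  rintro ⟨n, x, hx, hn⟩
  change ℤ → Fin 4 at x
  dsimp only at hx hn
  obtain ⟨m, rfl | rfl⟩ := Int.even_or_odd' n
  · have h := hn m
    rw [show 2 * m - m = m by ring] at h
    generalize x m = a at h
    revert a
    decide
  · have h := hn m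
    have h' := hx m
    rw [show 2 * m + 1 - m = m + 1 by ring] at h
    have key : ∀ a b : Fin 4,
        (!![0,0,1,0; 0,0,0,1; 1,0,0,0; 0,1,0,0] : Matrix (Fin 4) (Fin 4) ℤ) a b = 1 →
        (!![0,1,0,1; 1,0,1,0; 0,1,0,1; 1,0,1,0] : Matrix (Fin 4) (Fin 4) ℤ) a b ≠ 1 := by
      intro a b; fin_cases a <;> fin_cases b <;> simp
    exact key _ _ h h'

/-- For the given `4×4` flip pairs `(A, J)` and `(A, I)`:
(i) there is no strong shift-flip equivalence of any positive lag from `(A, J)` to `(A, I)`;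
(ii) the flip systems `(X_A, σ_A, φ_{I,A})` and `(X_A, σ_A, σ_A ∘ φ_{I,A})` are not
conjugate. -/
theorem stmt16 (A J : Matrix (Fin 4) (Fin 4) ℤ)
    (hA : A = !![0,1,0,1; 1,0,1,0; 0,1,0,1; 1,0,1,0])
    (hJ : J = !![0,0,1,0; 0,0,0,1; 1,0,0,0; 0,1,0,0])
    (τI : Fin 4 → Fin 4) (hτI : ∀ a b, (1 : Matrix (Fin 4) (Fin 4) ℤ) a b = 1 ↔ τI a = b)
    (φI : SFT A → SFT A) (hφI : ∀ x i, (φI x).1 i = τI (x.1 (-i))) :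
    (¬ ∃ k : ℕ, 0 < k ∧ SSFE (MatPair.mk (Fin 4) A J) (MatPair.mk (Fin 4) A 1) k) ∧
    (¬ ∃ θ : SFT A ≃ₜ SFT A,
        (∀ x, θ (shiftEquiv A x) = shiftEquiv A (θ x)) ∧
        (∀ x, θ (φI x) = shiftEquiv A (φI (θ x)))) := by
  subst hA hJ
  refine ⟨?_, ?_⟩
  · rintro ⟨k, -, h⟩
    refine not_hasReversiblePoint (h.hasReversiblePoint
      ⟨0, alternatingPoint, alternatingPoint_step, fun i => ?_⟩)
    rw [zero_sub, alternatingPoint_neg]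
    exact Matrix.one_apply_eq _
  · rintro ⟨θ, -, hθ⟩
    have hτ (a : Fin 4) : τI a = a := (hτI a a).1 (Matrix.one_apply_eq a)
    let p : SFT (!![0,1,0,1; 1,0,1,0; 0,1,0,1; 1,0,1,0] : Matrix (Fin 4) (Fin 4) ℤ) :=
      ⟨alternatingPoint, alternatingPoint_step⟩
    have hp : φI p = p := Subtype.ext (funext fun i => by
      rw [hφI, hτ]
      exact alternatingPoint_neg i)
    have hfix := hθ p
    rw [hp] at hfix
    have h : (θ p).1 (-1) = (φI (θ p)).1 (-1 + 1) :=
      congrFun (congrArg Subtype.val hfix) (-1)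
    rw [hφI, hτ] at h
    have hstep := (θ p).2 (-1)
    rw [h] at hstep
    norm_num at hstep
    generalize (θ p).1 0 = a at hstep
    revert a
    decide
end
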